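/- There is no realization of the group (ℤ/2ℤ)² by a 3-net in ℙ²(ℂ) with at least one class being a pencil: there do not exist injective maps p₁, p₂, p₃ : (ℤ/2ℤ)² → ℙ²(ℂ) with pairwise disjoint images such that for all x,y,z ∈ (ℤ/2ℤ)² the points p₁(x), p₂(y), p₃(z) are collinear if and only if x+y+z = 0, and such that the image of at least one of the maps p_i is contained in a line. -/

import Mathlib

/-- The complex projective plane ℙ²(ℂ) = ℙ(ℂ³). -/
abbrev P2 : Type := Projectivization ℂ (Fin 3 → ℂ)

/-- Three points of ℙ²(ℂ) are collinear if representative vectors in ℂ³ span a linear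
subspace of dimension at most 2. -/
def Collin (p q r : P2) : Prop :=
  Module.finrank ℂ (Submodule.span ℂ {p.rep, q.rep, r.rep} : Submodule ℂ (Fin 3 → ℂ)) ≤ 2

/-- A realization of a finite abelian group `H` by a 3-net in ℙ²(ℂ), stated dually in
terms of the points dual to the lines of the net: three injective maps `H → ℙ²(ℂ)` with
pairwise disjoint images such that `p₁ x`, `p₂ y`, `p₃ z` are collinear iff
`x + y + z = 0`. -/
def Realizes {H : Type} [AddCommGroup H] (p₁ p₂ p₃ : H → P2) : Prop :=
  Function.Injective p₁ ∧ Function.Injective p₂ ∧ Function.Injective p₃ ∧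
  Disjoint (Set.range p₁) (Set.range p₂) ∧
  Disjoint (Set.range p₁) (Set.range p₃) ∧
  Disjoint (Set.range p₂) (Set.range p₃) ∧
  ∀ x y z : H, Collin (p₁ x) (p₂ y) (p₃ z) ↔ x + y + z = 0

/-- A line in ℙ²(ℂ): the set of points annihilated by a nonzero linear form on ℂ³. -/
def IsProjLine (L : Set P2) : Prop :=
  ∃ f : (Fin 3 → ℂ) →ₗ[ℂ] ℂ, f ≠ 0 ∧ L = {p : P2 | f p.rep = 0}

lemma P2.eq_of_smul {p q : P2} {s t : ℂ} (h : s • p.rep = t • q.rep) (hs : s ≠ 0) : p = q := by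
  rw [← p.mk_rep, ← q.mk_rep, Projectivization.mk_eq_mk_iff']
  refine ⟨s⁻¹ * t, ?_⟩
  rw [mul_smul, ← h, smul_smul, inv_mul_cancel₀ hs, one_smul]

lemma P2.coeff_zero {p q : P2} {s t : ℂ} (hpq : p ≠ q) (h : s • p.rep = t • q.rep) : s = 0 := by
  by_contra hs
  exact hpq (P2.eq_of_smul h hs)

lemma Collin.dep {p q r : P2} (h : Collin p q r) :
    ∃ a b c : ℂ, a • p.rep + b • q.rep + c • r.rep = 0 ∧ ¬ (a = 0 ∧ b = 0 ∧ c = 0) := by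
  by_contra hcon
  push Not at hcon
  have hli : LinearIndependent ℂ ![p.rep, q.rep, r.rep] := by
    rw [Fintype.linearIndependent_iff]
    intro g hg
    rw [Fin.sum_univ_three] at hg
    obtain ⟨h0, h1, h2⟩ := hcon (g 0) (g 1) (g 2) (by simpa using hg)
    intro i
    fin_cases i <;> assumption
  have h3 := finrank_span_eq_card hli
  have hr : Set.range ![p.rep, q.rep, r.rep] = {p.rep, q.rep, r.rep} := by
    ext v
    simp
    tauto
  rw [hr] at h3
  unfold Collin at h
  simp at h3
  omega

lemma collin_of_ker {p q r : P2} {f : (Fin 3 → ℂ) →ₗ[ℂ] ℂ} (hf : f ≠ 0)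
    (hp : f p.rep = 0) (hq : f q.rep = 0) (hr : f r.rep = 0) : Collin p q r := by
  have hle : Submodule.span ℂ {p.rep, q.rep, r.rep} ≤ LinearMap.ker f := by
    rw [Submodule.span_le]
    rintro v (rfl | rfl | rfl) <;> simpa
  have h1 := Submodule.finrank_mono hle
  have hlt : LinearMap.ker f < ⊤ := lt_top_iff_ne_top.2 (by simpa [LinearMap.ker_eq_top] using hf)
  have h2 := Submodule.finrank_lt hlt.ne
  simp at h2
  unfold Collin
  omega

lemma off_line {p q r : ZMod 2 × ZMod 2 → P2} {f : (Fin 3 → ℂ) →ₗ[ℂ] ℂ} (hf : f ≠ 0)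
    (hpr : ∀ x y, p x ≠ r y) (hcol : ∀ x y z, Collin (p x) (q y) (r z) ↔ x + y + z = 0)
    (hr : ∀ z, f (r z).rep = 0) (x : ZMod 2 × ZMod 2) : f (p x).rep ≠ 0 := by
  intro hx
  obtain ⟨a, b, c, h, hne⟩ := ((hcol x x 0).2 (by clear * -; revert x; decide)).dep
  have hfh := congrArg f h
  simp [hx, hr] at hfh
  rcases hfh with hb | hq
  · subst hb
    have h' : a • (p x).rep = (-c) • (r 0).rep := by
      rw [zero_smul, add_zero] at h
      rw [neg_smul]; exact eq_neg_of_add_eq_zero_left h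
    have ha := P2.coeff_zero (hpr x 0) h'
    subst ha
    have hc : c = 0 := by simpa [(r 0).rep_nonzero] using h'
    exact hne ⟨rfl, rfl, hc⟩
  · have := (hcol x x (1, 0)).1 (collin_of_ker hf hx hq (hr _))
    revert this; clear * -; revert x; decide

lemma core {p q r : ZMod 2 × ZMod 2 → P2} {f : (Fin 3 → ℂ) →ₗ[ℂ] ℂ} (hf : f ≠ 0)
    (hinj : Function.Injective r) (hpq : ∀ x y, p x ≠ q y)
    (hpr : ∀ x y, p x ≠ r y) (hqr : ∀ x y, q x ≠ r y)
    (hcol : ∀ x y z, Collin (p x) (q y) (r z) ↔ x + y + z = 0)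
    (hr : ∀ z, f (r z).rep = 0) : False := by
  have hp := off_line hf hpr hcol hr
  have hq : ∀ y, f (q y).rep ≠ 0 := by
    refine off_line (q := p) hf hqr (fun x y z => ?_) hr
    rw [add_comm x y, ← hcol y x z]
    unfold Collin
    rw [Set.insert_comm]
  have key : ∀ x z, ∃ l : ℂ, (f (p x).rep)⁻¹ • (p x).rep - (f (q (x + z)).rep)⁻¹ • (q (x + z)).rep
      = l • (r z).rep := by
    intro x z
    obtain ⟨a, b, c, h, hne⟩ := ((hcol x (x + z) z).2 (by clear * -; revert x z; decide)).dep
    have hfh := congrArg f h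
    simp [hr] at hfh
    have hp' := hp x
    have hq' := hq (x + z)
    generalize f (p x).rep = P at *
    generalize f (q (x + z)).rep = Q at *
    have ha : a ≠ 0 := by
      rintro rfl
      have hb : b = 0 := by simpa [hq'] using hfh
      subst hb
      have hc : c = 0 := by simpa [(r z).rep_nonzero] using h
      exact hne ⟨rfl, rfl, hc⟩
    refine ⟨-c / (a * P), ?_⟩
    have hb : b = - (a * P) / Q := by
      field_simp
      linear_combination hfh
    subst hb
    ext i
    have hi := congrFun h i
    simp at hi ⊢
    field_simp at hi ⊢
    linear_combination hi
  choose l hl using key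
  have anti : ∀ x z d, d ≠ 0 → l x z + l (x + d) z = 0 := by
    intro x z d hd
    have hne : r z ≠ r (z + d) := fun h => hd (by simpa using hinj h)
    apply P2.coeff_zero hne (t := l x (z + d) + l (x + d) (z + d))
    have e1 := hl x z
    have e2 := hl (x + d) z
    have e3 := hl x (z + d)
    have e4 := hl (x + d) (z + d)
    have i1 : x + d + z = x + (z + d) := by abel
    have i2 : x + d + (z + d) = x + z := by clear * -; revert x z d; decide
    rw [i1] at e2
    rw [i2] at e4
    rw [add_smul, add_smul, ← e1, ← e2, ← e3, ← e4]
    abel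
  have h1 := anti (0, 0) 0 (1, 0) (by decide)
  have h2 := anti (1, 0) 0 (0, 1) (by decide)
  have h3 := anti (1, 1) 0 (1, 1) (by decide)
  have j1 : ((0, 0) + (1, 0) : ZMod 2 × ZMod 2) = (1, 0) := by decide
  have j2 : ((1, 0) + (0, 1) : ZMod 2 × ZMod 2) = (1, 1) := by decide
  have j3 : ((1, 1) + (1, 1) : ZMod 2 × ZMod 2) = (0, 0) := by decide
  rw [j1] at h1
  rw [j2] at h2
  rw [j3] at h3
  have h0 : l (0, 0) 0 = 0 := by linear_combination (h1 - h2 + h3) / 2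
  have e := hl (0, 0) 0
  rw [h0, zero_smul, sub_eq_zero] at e
  exact hpq _ _ (P2.eq_of_smul e (inv_ne_zero (hp _)))


/-- There is no realization of (ℤ/2ℤ)² by a 3-net in ℙ²(ℂ) with at least
one class being a pencil (dually: with the image of one of the three maps contained in a
line). -/
theorem no_realization_Z2_squared_with_pencil :
    ¬ ∃ p₁ p₂ p₃ : (ZMod 2 × ZMod 2) → P2, Realizes p₁ p₂ p₃ ∧
      ∃ L : Set P2, IsProjLine L ∧
        (Set.range p₁ ⊆ L ∨ Set.range p₂ ⊆ L ∨ Set.range p₃ ⊆ L) := by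
  rintro ⟨p, q, r, ⟨ip, iq, ir, dpq, dpr, dqr, hcol⟩, L, ⟨f, hf, rfl⟩, hL⟩
  have ne : ∀ {s t : ZMod 2 × ZMod 2 → P2}, Disjoint (Set.range s) (Set.range t) →
      ∀ x y, s x ≠ t y := fun h x y e =>
    Set.disjoint_left.1 h ⟨x, rfl⟩ ⟨y, e.symm⟩
  rcases hL with h | h | h
  · refine core hf ip (ne dqr) (ne dpq.symm) (ne dpr.symm) (fun x y z => ?_) (fun z => h ⟨z, rfl⟩)
    rw [show x + y + z = z + x + y by abel, ← hcol z x y]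
    unfold Collin
    rw [show ({(q x).rep, (r y).rep, (p z).rep} : Set (Fin 3 → ℂ)) =
      {(p z).rep, (q x).rep, (r y).rep} by ext; simp; tauto]
  · refine core hf iq (ne dpr) (ne dpq) (ne dqr.symm) (fun x y z => ?_) (fun z => h ⟨z, rfl⟩)
    rw [show x + y + z = x + z + y by abel, ← hcol x z y]
    unfold Collin
    rw [show ({(p x).rep, (r y).rep, (q z).rep} : Set (Fin 3 → ℂ)) =
      {(p x).rep, (q z).rep, (r y).rep} by ext; simp; tauto]
  · exact core hf ir (ne dpq) (ne dpr) (ne dqr) hcol (fun z => h ⟨z, rfl⟩)
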